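/- Let t₀ ∈ ℝ, v₁ > 0, N₁ > 0, l > 0, F₀ ≥ 0, r ≥ 0, and define ỹ_k : [t₀, ∞) → ℝ recursively by ỹ₁(t) = N₁((r − F₀/v₁)·e^{−v₁(t−t₀)} + F₀/v₁) and ỹ_{k+1}(t) = N₁·l·∫_{t₀}^{t} e^{−v₁(t−τ)} ỹ_k(τ) dτ. If l·N₁ < v₁, then for every t ≥ t₀ the series Σ_{k=1}^{∞} |ỹ_k(t)| converges. -/

import Mathlib

open Real Filter intervalIntegral

theorem integral_exp_neg_mul_sub (v a t : ℝ) (hv : v ≠ 0) :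
    ∫ τ in a..t, Real.exp (-v * (t - τ)) = (1 - Real.exp (-v * (t - a))) / v := by
  have hderiv : ∀ τ ∈ Set.uIcc a t,
      HasDerivAt (fun τ => Real.exp (-v * (t - τ)) / v) (Real.exp (-v * (t - τ))) τ := by
    intro τ _
    have h := ((((hasDerivAt_id τ).const_sub t).const_mul (-v)).exp).div_const v
    refine h.congr_deriv ?_
    simp only [id, mul_neg, mul_one, neg_neg]
    exact mul_div_cancel_right₀ _ hv
  rw [integral_eq_sub_of_hasDerivAt hderiv (Continuous.intervalIntegrable (by fun_prop) _ _)]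
  simp [sub_div]

/-- Convolution with a decaying exponential kernel on `[a, t]` scales a uniform bound by at most
`1 / v`; no measurability of `f` is needed. -/
theorem abs_integral_exp_neg_mul_le {v a t C : ℝ} {f : ℝ → ℝ} (hv : 0 < v) (hC : 0 ≤ C)
    (hat : a ≤ t) (hf : ∀ τ, a ≤ τ → |f τ| ≤ C) :
    |∫ τ in a..t, Real.exp (-v * (t - τ)) * f τ| ≤ C / v := by
  have hbound : ‖∫ τ in a..t, Real.exp (-v * (t - τ)) * f τ‖
      ≤ ∫ τ in a..t, Real.exp (-v * (t - τ)) * C := by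
    refine norm_integral_le_of_norm_le hat (Eventually.of_forall fun τ hτ => ?_)
      (Continuous.intervalIntegrable (by fun_prop) _ _)
    rw [norm_mul, Real.norm_eq_abs, Real.norm_eq_abs, Real.abs_exp]
    exact mul_le_mul_of_nonneg_left (hf τ hτ.1.le) (Real.exp_pos _).le
  refine hbound.trans ?_
  rw [intervalIntegral.integral_mul_const, integral_exp_neg_mul_sub v a t hv.ne', div_mul_eq_mul_div]
  gcongr
  exact mul_le_of_le_one_left hC (by linarith [Real.exp_pos (-v * (t - a))])

/-- Absolute convergence (Theorem 3): if `l·N₁ < v₁`, the series `Σ_{k≥1} |ỹ_k(t)|`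
of the majorant iterates converges for every `t ≥ t₀`. -/
theorem stmt_2 (t₀ v₁ N₁ l F₀ r : ℝ) (hv : 0 < v₁) (hN : 0 < N₁) (hl : 0 < l)
    (hF : 0 ≤ F₀) (hr : 0 ≤ r)
    (ytil : ℕ → ℝ → ℝ)
    (hbase : ∀ t, t₀ ≤ t →
      ytil 1 t = N₁ * ((r - F₀ / v₁) * Real.exp (-v₁ * (t - t₀)) + F₀ / v₁))
    (hrec : ∀ k, 1 ≤ k → ∀ t, t₀ ≤ t →
      ytil (k + 1) t = N₁ * l * ∫ τ in t₀..t, Real.exp (-v₁ * (t - τ)) * ytil k τ)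
    (hratio : l * N₁ < v₁) :
    ∀ t, t₀ ≤ t → Summable (fun k : ℕ => |ytil (k + 1) t|) := by
  set M : ℝ := N₁ * (|r - F₀ / v₁| + F₀ / v₁) with hM
  have hM0 : 0 ≤ M := by positivity
  have hq0 : 0 ≤ l * N₁ / v₁ := by positivity
  have hgeom : ∀ k : ℕ, ∀ t, t₀ ≤ t → |ytil (k + 1) t| ≤ M * (l * N₁ / v₁) ^ k := by
    intro k
    induction k with
    | zero =>
      intro t ht
      have hexp : Real.exp (-v₁ * (t - t₀)) ≤ 1 :=
        Real.exp_le_one_iff.2 (by nlinarith)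
      rw [zero_add, hbase t ht, pow_zero, mul_one, abs_mul, abs_of_pos hN, hM]
      gcongr
      refine (abs_add_le _ _).trans ?_
      rw [abs_mul, Real.abs_exp, abs_of_nonneg (div_nonneg hF hv.le)]
      gcongr
      exact mul_le_of_le_one_right (abs_nonneg _) hexp
    | succ k ih =>
      intro t ht
      rw [hrec (k + 1) (by omega) t ht, abs_mul, abs_of_pos (mul_pos hN hl)]
      calc _ ≤ N₁ * l * (M * (l * N₁ / v₁) ^ k / v₁) := by
            gcongr
            exact abs_integral_exp_neg_mul_le hv (by positivity) ht ih
        _ = M * (l * N₁ / v₁) ^ (k + 1) := by rw [pow_succ]; ring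
  intro t ht
  exact Summable.of_nonneg_of_le (fun _ => abs_nonneg _) (fun k => hgeom k t ht)
    ((summable_geometric_of_lt_one hq0 ((div_lt_one hv).2 hratio)).mul_left M)
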